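/- arXiv:2312.10364 — 2 statements merged into one kernel-verified Lean document; each statement's English description precedes it below -/
import Mathlib

section
/- The smooth function f(x,y,z) = x² + (z + xy/2)² on the Heisenberg group ℍ satisfies L*[f](p) > 0 and overline{L[f]}(p) ≥ 0 for every p ∈ ℍ, attains no local maximum in ℍ, and is not h-quasiconvex in ℍ. -/
open Filter Topology

noncomputable section

abbrev Heis := ℝ × ℝ × ℝ

def hMul (p q : Heis) : Heis :=
  (p.1 + q.1, p.2.1 + q.2.1, p.2.2 + q.2.2 + (p.1 * q.2.1 - q.1 * p.2.1) / 2)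

def horiz : Set Heis := {h : Heis | h.2.2 = 0}

def hPlane (p : Heis) : Set Heis := {q : Heis | ∃ h ∈ horiz, q = hMul p h}

def hSeg (p q : Heis) : Set Heis :=
  {w : Heis | ∃ l : ℝ, 0 ≤ l ∧ l ≤ 1 ∧ w = l • p + (1 - l) • q}

def HConvex (E : Set Heis) : Prop :=
  ∀ p ∈ E, ∀ q ∈ E, q ∈ hPlane p → hSeg p q ⊆ E

def HQuasiconvexOn (f : Heis → ℝ) (Ω : Set Heis) : Prop :=
  ∀ p ∈ Ω, ∀ q ∈ Ω, q ∈ hPlane p → ∀ w ∈ hSeg p q, f w ≤ max (f p) (f q)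

def X1 (f : Heis → ℝ) (p : Heis) : ℝ :=
  fderiv ℝ f p (1, 0, 0) - p.2.1 / 2 * fderiv ℝ f p (0, 0, 1)

def X2 (f : Heis → ℝ) (p : Heis) : ℝ :=
  fderiv ℝ f p (0, 1, 0) + p.1 / 2 * fderiv ℝ f p (0, 0, 1)

def gradH (f : Heis → ℝ) (p : Heis) : ℝ × ℝ := (X1 f p, X2 f p)

def hessH (f : Heis → ℝ) (p : Heis) : ℝ × ℝ × ℝ :=
  (X1 (X1 f) p, (X1 (X2 f) p + X2 (X1 f) p) / 2, X2 (X2 f) p)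

def L0H (ξ : ℝ × ℝ) (A : ℝ × ℝ × ℝ) : ℝ :=
  sInf {m : ℝ | ∃ η : ℝ × ℝ, η.1 ^ 2 + η.2 ^ 2 = 1 ∧ ξ.1 * η.1 + ξ.2 * η.2 = 0 ∧
    m = A.1 * η.1 ^ 2 + 2 * A.2.1 * η.1 * η.2 + A.2.2 * η.2 ^ 2}

def Lop (f : Heis → ℝ) (p : Heis) : ℝ := L0H (gradH f p) (hessH f p)

def LbarOp (f : Heis → ℝ) (p : Heis) : ℝ := limsup (Lop f) (𝓝 p)

def LstarOp (f : Heis → ℝ) (p : Heis) : ℝ :=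
  limsup (fun q : (ℝ × ℝ) × ℝ × ℝ × ℝ => L0H q.1 q.2) (𝓝 (gradH f p, hessH f p))

def StrictLocalMaxOnSet (g : Heis → ℝ) (Ω : Set Heis) (p : Heis) : Prop :=
  ∃ U ∈ 𝓝 p, ∀ q ∈ U ∩ Ω, q ≠ p → g q < g p

def UniformlyHQuasiconvexOn (f : Heis → ℝ) (Ω : Set Heis) (r₀ lam : ℝ) : Prop :=
  ∀ r : ℝ, 0 < r → r < r₀ → ∀ p ∈ Ω, ∀ v ∈ horiz, v.1 ^ 2 + v.2.1 ^ 2 = 1 →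
    hMul p (r • v) ∈ Ω → hMul p (-(r • v)) ∈ Ω →
    f p ≤ max (f (hMul p (r • v))) (f (hMul p (-(r • v)))) - lam * r ^ 2

def gaugeK (p : Heis) : ℝ := ((p.1 ^ 2 + p.2.1 ^ 2) ^ 2 + 16 * p.2.2 ^ 2) ^ ((1 : ℝ) / 4)

theorem bddBelow_quadratic_on_unit (ξ : ℝ × ℝ) (A : ℝ × ℝ × ℝ) :
    BddBelow {m : ℝ | ∃ η : ℝ × ℝ, η.1 ^ 2 + η.2 ^ 2 = 1 ∧ ξ.1 * η.1 + ξ.2 * η.2 = 0 ∧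
      m = A.1 * η.1 ^ 2 + 2 * A.2.1 * η.1 * η.2 + A.2.2 * η.2 ^ 2} := by
  refine ⟨-(|A.1| + |A.2.1| + |A.2.2|), ?_⟩
  rintro m ⟨⟨a, b⟩, h, -, rfl⟩
  simp only at h ⊢
  have h1 : -|A.1| ≤ A.1 * a ^ 2 := by
    nlinarith [neg_abs_le A.1, abs_nonneg A.1, sq_nonneg a, sq_nonneg b]
  have h2 : -|A.2.2| ≤ A.2.2 * b ^ 2 := by
    nlinarith [neg_abs_le A.2.2, abs_nonneg A.2.2, sq_nonneg a, sq_nonneg b]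
  have h3 : |2 * (a * b)| ≤ 1 := by
    rw [abs_le]; constructor <;> nlinarith [sq_nonneg (a - b), sq_nonneg (a + b)]
  have h4 : |A.2.1 * (2 * (a * b))| ≤ |A.2.1| := by
    rw [abs_mul]; exact mul_le_of_le_one_right (abs_nonneg _) h3
  nlinarith [neg_abs_le (A.2.1 * (2 * (a * b)))]

theorem exists_unit_orthogonal (ξ : ℝ × ℝ) :
    ∃ η : ℝ × ℝ, η.1 ^ 2 + η.2 ^ 2 = 1 ∧ ξ.1 * η.1 + ξ.2 * η.2 = 0 := by
  by_cases h : ξ.1 ^ 2 + ξ.2 ^ 2 = 0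
  · have h1 : ξ.1 = 0 := by nlinarith [sq_nonneg ξ.1, sq_nonneg ξ.2]
    have h2 : ξ.2 = 0 := by nlinarith [sq_nonneg ξ.1, sq_nonneg ξ.2]
    exact ⟨(1, 0), by norm_num, by simp [h1]⟩
  · have hn : 0 ≤ ξ.1 ^ 2 + ξ.2 ^ 2 := by positivity
    have hs : √(ξ.1 ^ 2 + ξ.2 ^ 2) ≠ 0 := by
      rwa [Real.sqrt_ne_zero hn]
    refine ⟨(-ξ.2 / √(ξ.1 ^ 2 + ξ.2 ^ 2), ξ.1 / √(ξ.1 ^ 2 + ξ.2 ^ 2)), ?_, ?_⟩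
    · simp only [div_pow, Real.sq_sqrt hn]
      field_simp
      ring
    · simp only
      field_simp
      ring

theorem le_L0H {ξ : ℝ × ℝ} {A : ℝ × ℝ × ℝ} {c : ℝ}
    (h : ∀ a b : ℝ, a ^ 2 + b ^ 2 = 1 → ξ.1 * a + ξ.2 * b = 0 →
      c ≤ A.1 * a ^ 2 + 2 * A.2.1 * a * b + A.2.2 * b ^ 2) :
    c ≤ L0H ξ A := by
  obtain ⟨η, h1, h2⟩ := exists_unit_orthogonal ξ
  refine le_csInf ⟨_, η, h1, h2, rfl⟩ ?_
  rintro m ⟨η, h1, h2, rfl⟩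
  exact h _ _ h1 h2

theorem L0H_le (ξ : ℝ × ℝ) (A : ℝ × ℝ × ℝ) : L0H ξ A ≤ |A.1| + |A.2.1| + |A.2.2| := by
  obtain ⟨⟨a, b⟩, h, h'⟩ := exists_unit_orthogonal ξ
  refine (csInf_le (bddBelow_quadratic_on_unit ξ A) ⟨(a, b), h, h', rfl⟩).trans ?_
  simp only at h ⊢
  have h1 : A.1 * a ^ 2 ≤ |A.1| := by
    nlinarith [le_abs_self A.1, abs_nonneg A.1, sq_nonneg a, sq_nonneg b]
  have h2 : A.2.2 * b ^ 2 ≤ |A.2.2| := by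
    nlinarith [le_abs_self A.2.2, abs_nonneg A.2.2, sq_nonneg a, sq_nonneg b]
  have h3 : |2 * (a * b)| ≤ 1 := by
    rw [abs_le]; constructor <;> nlinarith [sq_nonneg (a - b), sq_nonneg (a + b)]
  have h4 : |A.2.1 * (2 * (a * b))| ≤ |A.2.1| := by
    rw [abs_mul]; exact mul_le_of_le_one_right (abs_nonneg _) h3
  nlinarith [le_abs_self (A.2.1 * (2 * (a * b)))]

theorem isBoundedUnder_L0H {α : Type*} [TopologicalSpace α] {ξ : α → ℝ × ℝ}
    {A : α → ℝ × ℝ × ℝ} (hA : Continuous A) (x : α) :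
    IsBoundedUnder (· ≤ ·) (𝓝 x) fun q => L0H (ξ q) (A q) := by
  have hc : Continuous fun q => |(A q).1| + |(A q).2.1| + |(A q).2.2| := by fun_prop
  exact (hc.tendsto x).isBoundedUnder_le.mono_le (Eventually.of_forall fun q => L0H_le _ _)

theorem hasFDerivAt_heis_fst (p : Heis) :
    HasFDerivAt (fun q : Heis => q.1) (ContinuousLinearMap.fst ℝ ℝ (ℝ × ℝ)) p :=
  hasFDerivAt_fst

theorem hasFDerivAt_heis_snd (p : Heis) :
    HasFDerivAt (fun q : Heis => q.2.1)
      ((ContinuousLinearMap.fst ℝ ℝ ℝ).comp (ContinuousLinearMap.snd ℝ ℝ (ℝ × ℝ))) p :=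
  ((ContinuousLinearMap.fst ℝ ℝ ℝ).comp (ContinuousLinearMap.snd ℝ ℝ (ℝ × ℝ))).hasFDerivAt

theorem hasFDerivAt_heis_trd (p : Heis) :
    HasFDerivAt (fun q : Heis => q.2.2)
      ((ContinuousLinearMap.snd ℝ ℝ ℝ).comp (ContinuousLinearMap.snd ℝ ℝ (ℝ × ℝ))) p :=
  ((ContinuousLinearMap.snd ℝ ℝ ℝ).comp (ContinuousLinearMap.snd ℝ ℝ (ℝ × ℝ))).hasFDerivAt

/-- The function `x² + (z + x y / 2)²`. -/
def modelFun (p : Heis) : ℝ := p.1 ^ 2 + (p.2.2 + p.1 * p.2.1 / 2) ^ 2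

theorem hasFDerivAt_shear (p : Heis) :
    HasFDerivAt (fun q : Heis => q.2.2 + q.1 * q.2.1 / 2)
      ((ContinuousLinearMap.snd ℝ ℝ ℝ).comp (ContinuousLinearMap.snd ℝ ℝ (ℝ × ℝ)) +
        (2⁻¹ : ℝ) • (p.1 • (ContinuousLinearMap.fst ℝ ℝ ℝ).comp
          (ContinuousLinearMap.snd ℝ ℝ (ℝ × ℝ)) +
          p.2.1 • ContinuousLinearMap.fst ℝ ℝ (ℝ × ℝ))) p := by
  simp only [div_eq_inv_mul]
  exact (hasFDerivAt_heis_trd p).add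
    (((hasFDerivAt_heis_fst p).mul (hasFDerivAt_heis_snd p)).const_mul (2⁻¹ : ℝ))

theorem X1_modelFun : X1 modelFun = fun p => 2 * p.1 := by
  funext p
  have h : HasFDerivAt modelFun _ p :=
    ((hasFDerivAt_heis_fst p).pow 2).add ((hasFDerivAt_shear p).pow 2)
  simp [X1, h.fderiv]
  ring

theorem X2_modelFun :
    X2 modelFun = fun p => 2 * ((p.2.2 + p.1 * p.2.1 / 2) * p.1) := by
  funext p
  have h : HasFDerivAt modelFun _ p :=
    ((hasFDerivAt_heis_fst p).pow 2).add ((hasFDerivAt_shear p).pow 2)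
  simp [X2, h.fderiv]
  ring

theorem gradH_modelFun (p : Heis) :
    gradH modelFun p = (2 * p.1, 2 * ((p.2.2 + p.1 * p.2.1 / 2) * p.1)) := by
  simp only [gradH, X1_modelFun, X2_modelFun]

theorem hessH_modelFun (p : Heis) :
    hessH modelFun p = (2, p.2.2 + p.1 * p.2.1 / 2, 2 * p.1 ^ 2) := by
  have h1 : HasFDerivAt (fun q : Heis => 2 * q.1) _ p := (hasFDerivAt_heis_fst p).const_mul 2
  have h2 : HasFDerivAt (fun q : Heis => 2 * ((q.2.2 + q.1 * q.2.1 / 2) * q.1)) _ p :=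
    ((hasFDerivAt_shear p).mul (hasFDerivAt_heis_fst p)).const_mul 2
  simp only [hessH, X1_modelFun, X2_modelFun]
  simp only [X1, X2, h1.fderiv, h2.fderiv]
  refine Prod.ext ?_ (Prod.ext ?_ ?_) <;> simp <;> ring

theorem le_Lop_modelFun {p : Heis} (hp : p.1 ≠ 0) :
    2 * p.1 ^ 2 / (1 + (p.2.2 + p.1 * p.2.1 / 2) ^ 2) ≤ Lop modelFun p := by
  rw [Lop, gradH_modelFun, hessH_modelFun]
  generalize p.2.2 + p.1 * p.2.1 / 2 = u
  refine le_L0H fun a b h1 h2 => ?_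
  simp only at h2 ⊢
  have ha : a = -(u * b) := by
    have : p.1 * (a + u * b) = 0 := by linarith
    rcases mul_eq_zero.1 this with h | h
    · exact absurd h hp
    · linarith
  subst ha
  rw [div_le_iff₀ (by positivity)]
  have hb : b ^ 2 * (1 + u ^ 2) = 1 := by linarith
  apply le_of_eq
  linear_combination (-2 * p.1 ^ 2) * hb

theorem frequently_fst_ne_zero (p : Heis) : ∃ᶠ q in 𝓝 p, q.1 ≠ 0 := by
  have hd : Dense {q : Heis | q.1 ≠ 0} := by
    have := (dense_compl_singleton (0 : ℝ)).preimage (isOpenMap_fst (X := ℝ) (Y := ℝ × ℝ))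
    exact this
  exact mem_closure_iff_frequently.1 (hd p)

theorem LbarOp_modelFun_nonneg (p : Heis) : 0 ≤ LbarOp modelFun p := by
  refine le_limsup_of_frequently_le
    ((frequently_fst_ne_zero p).mono fun q hq => le_trans (by positivity) (le_Lop_modelFun hq)) ?_
  have hA : Continuous (hessH modelFun) := by
    rw [funext hessH_modelFun]; fun_prop
  exact isBoundedUnder_L0H hA p

theorem LstarOp_modelFun_pos (p : Heis) : 0 < LstarOp modelFun p := by
  have hb := isBoundedUnder_L0H (ξ := Prod.fst) (continuous_snd (X := ℝ × ℝ) (Y := ℝ × ℝ × ℝ))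
    (gradH modelFun p, hessH modelFun p)
  by_cases hp : p.1 = 0
  · refine lt_of_lt_of_le two_pos (le_limsup_of_frequently_le ?_ hb)
    rw [gradH_modelFun, hessH_modelFun]
    generalize p.2.2 + p.1 * p.2.1 / 2 = u
    simp only [hp]
    have ht : Tendsto (fun ε : ℝ => (((0 : ℝ), ε), ((2 : ℝ), u, (0 : ℝ)))) (𝓝[≠] 0)
        (𝓝 (((0 : ℝ), (0 : ℝ)), ((2 : ℝ), u, (0 : ℝ)))) := by
      have hc : Continuous fun ε : ℝ => (((0 : ℝ), ε), ((2 : ℝ), u, (0 : ℝ))) := by fun_prop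
      exact (hc.tendsto 0).mono_left nhdsWithin_le_nhds
    have hf : ∀ᶠ ε : ℝ in 𝓝[≠] 0, 2 ≤ L0H (0, ε) (2, u, 0) := by
      filter_upwards [self_mem_nhdsWithin] with ε hε
      refine le_L0H fun a b h1 h2 => ?_
      have hb : b = 0 := by simpa [show ε ≠ 0 from hε] using h2
      subst hb
      simp only
      linarith
    simpa using ht.frequently hf.frequently
  · have h1 : 0 < 2 * p.1 ^ 2 / (1 + (p.2.2 + p.1 * p.2.1 / 2) ^ 2) := by positivity
    refine h1.trans_le (le_limsup_of_frequently_le ?_ hb)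
    have : ∃ᶠ q in pure (gradH modelFun p, hessH modelFun p),
        2 * p.1 ^ 2 / (1 + (p.2.2 + p.1 * p.2.1 / 2) ^ 2) ≤ L0H q.1 q.2 := by
      rw [frequently_pure]
      exact le_Lop_modelFun hp
    exact this.filter_mono (pure_le_nhds _)

theorem not_isLocalMax_modelFun (p : Heis) : ¬ IsLocalMax modelFun p := by
  intro h
  have key : ∀ s : ℝ, ∀ᶠ t in 𝓝[≠] (0 : ℝ),
      modelFun (p.1 + s * t, p.2.1, p.2.2 - s * t * p.2.1 / 2) ≤ modelFun p := by
    intro s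
    have hc : Continuous fun t : ℝ =>
        ((p.1 + s * t, p.2.1, p.2.2 - s * t * p.2.1 / 2) : Heis) := by fun_prop
    have ht := (hc.tendsto 0).mono_left (nhdsWithin_le_nhds (s := {0}ᶜ))
    simp only [mul_zero, zero_mul, zero_div, add_zero, sub_zero] at ht
    exact ht.eventually h
  obtain ⟨t, ⟨h1, h2⟩, ht⟩ :=
    (((key 1).and (key (-1))).and self_mem_nhdsWithin).exists
  have ht' : 0 < t ^ 2 := by
    have : t ≠ 0 := ht
    positivity
  simp only [modelFun] at h1 h2
  linarith

theorem not_hQuasiconvexOn_modelFun : ¬ HQuasiconvexOn modelFun Set.univ := by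
  intro h
  have := h (1 / 2, -4, 1) trivial (-1 / 2, 4, 1) trivial
    ⟨(-1, 8, 0), rfl, by norm_num [hMul]⟩ (0, 0, 1)
    ⟨1 / 2, by norm_num, by norm_num, by norm_num⟩
  norm_num [modelFun] at this

theorem statement4 (f : Heis → ℝ)
    (hf : f = fun p => p.1 ^ 2 + (p.2.2 + p.1 * p.2.1 / 2) ^ 2) :
    (∀ p : Heis, 0 < LstarOp f p ∧ 0 ≤ LbarOp f p) ∧
    (∀ p : Heis, ¬ IsLocalMax f p) ∧
    ¬ HQuasiconvexOn f Set.univ := by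
  obtain rfl : f = modelFun := hf
  exact ⟨fun p => ⟨LstarOp_modelFun_pos p, LbarOp_modelFun_nonneg p⟩,
    not_isLocalMax_modelFun, not_hQuasiconvexOn_modelFun⟩
end
end

section
/- Let Ω be an open set in the Heisenberg group ℍ and let f ∈ USC(Ω) be locally bounded. Suppose f satisfies the uniform h-quasiconvexity inequality with parameters r₀ > 0 and λ > 0, i.e., f(p) ≤ max{f(p·rv), f(p·rv⁻¹)} − λr² for all 0 < r < r₀, p ∈ Ω and v ∈ ℍ₀ with |v| = 1 such that p·rv, p·rv⁻¹ ∈ Ω. Then f is a viscosity subsolution of L[f] ≥ 2λ in Ω, i.e., whenever f − φ attains a strict local maximum at p̂ ∈ Ω for a smooth φ: Ω → ℝ, one has L[φ](p̂) ≥ 2λ. -/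
open Filter Topology

noncomputable section

/-- Horizontal right translation of `p` by `t • v` runs along a straight line in direction
`horizDir p v.1 v.2.1`. -/
def horizDir (p : Heis) (a b : ℝ) : Heis := (a, b, (p.1 * b - a * p.2.1) / 2)

theorem hMul_smul_eq (p v : Heis) (hv : v ∈ horiz) (t : ℝ) :
    hMul p (t • v) = p + t • horizDir p v.1 v.2.1 := by
  have hv' : v.2.2 = 0 := hv
  ext <;> simp [hMul, horizDir, hv']
  ring

theorem clm_horizDir (l : Heis →L[ℝ] ℝ) (p : Heis) (a b : ℝ) :
    l (horizDir p a b) = a * (l (1, 0, 0) - p.2.1 / 2 * l (0, 0, 1)) +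
      b * (l (0, 1, 0) + p.1 / 2 * l (0, 0, 1)) := by
  have h : horizDir p a b = a • ((1, 0, 0) : Heis) + b • ((0, 1, 0) : Heis) +
      ((p.1 * b - a * p.2.1) / 2) • ((0, 0, 1) : Heis) := by
    ext <;> simp [horizDir]
  rw [h]
  simp only [map_add, map_smul, smul_eq_mul]
  ring

theorem fderiv_horizDir (φ : Heis → ℝ) (p : Heis) (a b : ℝ) :
    fderiv ℝ φ p (horizDir p a b) = a * X1 φ p + b * X2 φ p :=
  clm_horizDir _ p a b

theorem fderiv_X1 {φ : Heis → ℝ} {p : Heis} (h : DifferentiableAt ℝ (fderiv ℝ φ) p) (u : Heis) :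
    fderiv ℝ (X1 φ) p u = fderiv ℝ (fderiv ℝ φ) p u (1, 0, 0) -
      p.2.1 / 2 * fderiv ℝ (fderiv ℝ φ) p u (0, 0, 1) - u.2.1 / 2 * fderiv ℝ φ p (0, 0, 1) := by
  have hc : HasFDerivAt (fun q : Heis => q.2.1 / 2)
      ((1 / 2 : ℝ) • (ContinuousLinearMap.fst ℝ ℝ ℝ).comp
        (ContinuousLinearMap.snd ℝ ℝ (ℝ × ℝ))) p := by
    refine (ContinuousLinearMap.hasFDerivAt _).congr_of_eventuallyEq (.of_forall fun q => ?_)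
    simp
    ring
  have hd (e : Heis) := h.hasFDerivAt.clm_apply (hasFDerivAt_const e p)
  have hX : HasFDerivAt (X1 φ) _ p := (hd (1, 0, 0)).sub (hc.mul (hd (0, 0, 1)))
  rw [hX.fderiv]
  simp
  ring

theorem fderiv_X2 {φ : Heis → ℝ} {p : Heis} (h : DifferentiableAt ℝ (fderiv ℝ φ) p) (u : Heis) :
    fderiv ℝ (X2 φ) p u = fderiv ℝ (fderiv ℝ φ) p u (0, 1, 0) +
      p.1 / 2 * fderiv ℝ (fderiv ℝ φ) p u (0, 0, 1) + u.1 / 2 * fderiv ℝ φ p (0, 0, 1) := by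
  have hc : HasFDerivAt (fun q : Heis => q.1 / 2)
      ((1 / 2 : ℝ) • ContinuousLinearMap.fst ℝ ℝ (ℝ × ℝ)) p := by
    refine (ContinuousLinearMap.hasFDerivAt _).congr_of_eventuallyEq (.of_forall fun q => ?_)
    simp
    ring
  have hd (e : Heis) := h.hasFDerivAt.clm_apply (hasFDerivAt_const e p)
  have hX : HasFDerivAt (X2 φ) _ p := (hd (0, 1, 0)).add (hc.mul (hd (0, 0, 1)))
  rw [hX.fderiv]
  simp
  ring

/-- The symmetrized horizontal Hessian is the restriction of the Euclidean second derivative to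
horizontal directions. -/
theorem fderiv_fderiv_horizDir {φ : Heis → ℝ} {p : Heis}
    (h : DifferentiableAt ℝ (fderiv ℝ φ) p) (a b : ℝ) :
    fderiv ℝ (fderiv ℝ φ) p (horizDir p a b) (horizDir p a b) =
      (hessH φ p).1 * a ^ 2 + 2 * (hessH φ p).2.1 * a * b + (hessH φ p).2.2 * b ^ 2 := by
  have e1 := fderiv_X1 h (horizDir p a b)
  have e2 := fderiv_X2 h (horizDir p a b)
  rw [fderiv_horizDir] at e1 e2
  simp only [horizDir] at e1 e2
  rw [clm_horizDir]
  simp only [hessH, horizDir]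
  linear_combination (-a) * e1 - b * e2

/-- Along a line on which the first derivative of `φ` vanishes at `p`, `φ` grows at most like
`c * t ^ 2` as soon as its second derivative is less than `2 * c`. -/
theorem eventually_le_add_mul_sq {φ : Heis → ℝ} (hφ : ContDiff ℝ 2 φ) (p w : Heis) (c : ℝ)
    (h1 : fderiv ℝ φ p w = 0) (h2 : fderiv ℝ (fderiv ℝ φ) p w w < 2 * c) :
    ∀ᶠ t : ℝ in 𝓝 0, φ (p + t • w) ≤ φ p + c * t ^ 2 := by
  have hline (t : ℝ) : HasDerivAt (fun t : ℝ => p + t • w) w t := by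
    simpa using ((hasDerivAt_id t).smul_const w).const_add p
  have hφd : Differentiable ℝ φ := hφ.differentiable (by norm_num)
  have hφd' : Differentiable ℝ (fderiv ℝ φ) :=
    (hφ.fderiv_right (m := 1) (by norm_num)).differentiable (by norm_num)
  have hsq (t : ℝ) : HasDerivAt (fun t : ℝ => c * t ^ 2) (2 * c * t) t :=
    ((hasDerivAt_pow 2 t).const_mul c).congr_deriv (by push_cast; ring)
  have hg (t : ℝ) : HasDerivAt (fun t : ℝ => c * t ^ 2 - φ (p + t • w))
      (2 * c * t - fderiv ℝ φ (p + t • w) w) t :=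
    (hsq t).sub ((hφd _).hasFDerivAt.comp_hasDerivAt t (hline t))
  have hderiv : deriv (fun t : ℝ => c * t ^ 2 - φ (p + t • w)) =
      fun t => 2 * c * t - fderiv ℝ φ (p + t • w) w := funext fun t => (hg t).deriv
  have hg' : HasDerivAt (fun t : ℝ => 2 * c * t - fderiv ℝ φ (p + t • w) w)
      (2 * c - fderiv ℝ (fderiv ℝ φ) p w w) 0 := by
    have hlin : HasDerivAt (fun t : ℝ => 2 * c * t) (2 * c) 0 := by
      simpa using (hasDerivAt_id (0 : ℝ)).const_mul (2 * c)
    have hD := ((hφd' _).hasFDerivAt.comp_hasDerivAt (0 : ℝ) (hline 0)).clm_apply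
      (hasDerivAt_const (0 : ℝ) w)
    exact (hlin.sub hD).congr_deriv (by simp)
  have hmin : IsLocalMin (fun t : ℝ => c * t ^ 2 - φ (p + t • w)) 0 := by
    refine isLocalMin_of_deriv_deriv_pos ?_ ?_ (hg 0).continuousAt
    · rw [hderiv, hg'.deriv]
      linarith
    · simp [hderiv, h1]
  filter_upwards [hmin] with t ht
  simp only [zero_smul, add_zero] at ht
  linarith

theorem statement8 (Ω : Set Heis) (hΩ : IsOpen Ω) (f : Heis → ℝ)
    (husc : UpperSemicontinuousOn f Ω)
    (hbd : ∀ p ∈ Ω, ∃ U ∈ 𝓝 p, ∃ M : ℝ, ∀ q ∈ U ∩ Ω, |f q| ≤ M)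
    (r₀ lam : ℝ) (hr₀ : 0 < r₀) (hlam : 0 < lam)
    (huqc : UniformlyHQuasiconvexOn f Ω r₀ lam) :
    ∀ φ : Heis → ℝ, ContDiff ℝ (⊤ : ℕ∞) φ → ∀ p ∈ Ω,
      StrictLocalMaxOnSet (fun q => f q - φ q) Ω p → 2 * lam ≤ Lop φ p := by
  intro φ hφ p hp ⟨U, hU, hmax⟩
  have hφ2 : ContDiff ℝ 2 φ := hφ.of_le (WithTop.coe_le_coe.mpr le_top)
  have hφd : DifferentiableAt ℝ (fderiv ℝ φ) p :=
    (hφ2.fderiv_right (m := 1) (by norm_num)).differentiable (by norm_num) p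
  refine le_csInf ?_ ?_
  · obtain ⟨η, hη, hη'⟩ := exists_unit_orthogonal (gradH φ p)
    exact ⟨_, η, hη, hη', rfl⟩
  rintro m ⟨⟨a, b⟩, hη, hη', rfl⟩
  rw [← fderiv_fderiv_horizDir hφd]
  by_contra! hlt
  have hgrad : fderiv ℝ φ p (horizDir p a b) = 0 := by
    rw [fderiv_horizDir, ← hη']
    simp only [gradH]
    ring
  set w := horizDir p a b with hw
  have hw0 : w ≠ 0 := by
    intro h0
    have ha : a = 0 := congrArg Prod.fst h0
    have hb : b = 0 := congrArg (fun q : Heis => q.2.1) h0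
    simp [ha, hb] at hη
  have hmem : ∀ᶠ t : ℝ in 𝓝 0, p + t • w ∈ U ∩ Ω := by
    have hc : ContinuousAt (fun t : ℝ => p + t • w) 0 := by fun_prop
    refine hc.eventually_mem ?_
    simpa using inter_mem hU (hΩ.mem_nhds hp)
  have hgood := (eventually_le_add_mul_sq hφ2 p w lam hgrad hlt).and hmem
  have hneg : Tendsto (fun t : ℝ => -t) (𝓝 0) (𝓝 0) := by
    simpa using (continuous_neg (G := ℝ)).tendsto 0
  obtain ⟨t, ⟨⟨hle, hin⟩, hle', hin'⟩, ht, htr⟩ :=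
    (((hgood.and (hneg.eventually hgood)).filter_mono nhdsWithin_le_nhds).and
      (Ioo_mem_nhdsGT hr₀ : ∀ᶠ t in 𝓝[>] 0, t ∈ Set.Ioo 0 r₀)).exists
  have key (s : ℝ) (hs : s ≠ 0) (hsle : φ (p + s • w) ≤ φ p + lam * s ^ 2)
      (hsin : p + s • w ∈ U ∩ Ω) : f (p + s • w) < f p + lam * s ^ 2 := by
    have := hmax _ hsin (by simp [hs, hw0])
    linarith
  have hv : ((a, b, 0) : Heis) ∈ horiz := rfl
  have e1 : hMul p (t • (a, b, 0)) = p + t • w := hMul_smul_eq p _ hv t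
  have e2 : hMul p (-(t • (a, b, 0))) = p + (-t) • w := by
    rw [← neg_smul]
    exact hMul_smul_eq p _ hv (-t)
  have hq := huqc t ht htr p hp (a, b, 0) hv hη (e1 ▸ hin.2) (e2 ▸ hin'.2)
  rw [e1, e2] at hq
  have k1 := key t ht.ne' hle hin
  have k2 := key (-t) (neg_ne_zero.mpr ht.ne') hle' hin'
  rw [neg_sq] at k2
  linarith [max_lt k1 k2]
end
end
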